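/- arXiv:0811.2191 — 2 statements merged into one kernel-verified Lean document; each statement's English description precedes it below -/
import Mathlib

section
/- Let f be an analytic function on the open unit disc with Re f > 0, f(0) = 1, and f'(0) = 0. Then there exists a Borel probability measure ν on the compact set Θ̂ of zero-mean probability measures on the circle supported on at most 3 points (with the weak-* topology) such that f(z) = ∫_Θ̂ h_ϑ(z) dν(ϑ) for all z in the disc, where h_ϑ(z) = ∫_𝕋 (w+z)/(w-z) dϑ(w). -/
open Complex MeasureTheory

/-- The unit circle in `ℂ`. -/
noncomputable abbrev UnitCircle := Metric.sphere (0 : ℂ) 1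

/-- `Θ̂`: the set of zero-mean Borel probability measures on the circle supported
on at most three points. -/
def ThetaHat : Set (Measure UnitCircle) :=
  {ϑ | IsProbabilityMeasure ϑ ∧ (∫ w : UnitCircle, (w : ℂ) ∂ϑ) = 0 ∧
    ∃ S : Finset UnitCircle, S.card ≤ 3 ∧ ϑ (↑S)ᶜ = 0}

theorem exists_isProbabilityMeasure_integral_eq {K E : Type*} [TopologicalSpace K] [CompactSpace K]
    [T2Space K] [MeasurableSpace K] [BorelSpace K] [AddCommGroup E] [Module ℝ E]
    (Φ : E →ₗ[ℝ] C(K, ℝ)) (Λ : E →ₗ[ℝ] ℝ) (e : E) (hΦ : Φ e = 1) (hΛ : Λ e = 1)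
    (hpos : ∀ g, 0 ≤ Φ g → 0 ≤ Λ g) :
    ∃ P : Measure K, IsProbabilityMeasure P ∧ ∀ g, ∫ k, Φ g k ∂P = Λ g := by
  obtain ⟨L, hL⟩ : ∃ L : C(K, ℝ) →ₗ[ℝ] ℝ, L ∘ₗ Φ = Λ := by
    have hmem : Λ ∈ LinearMap.range Φ.dualMap := by
      rw [LinearMap.range_dualMap_eq_dualAnnihilator_ker, Submodule.mem_dualAnnihilator]
      intro g hg
      rw [LinearMap.mem_ker] at hg
      refine le_antisymm ?_ (hpos g hg.ge)
      simpa using hpos (-g) (by simp [hg])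
    exact hmem
  obtain ⟨M, hMΦ, hM⟩ := riesz_extension (PointedCone.positive ℝ C(K, ℝ))
    ⟨LinearMap.range Φ, L ∘ₗ (LinearMap.range Φ).subtype⟩
    (by
      rintro ⟨_, g, rfl⟩ hg
      have := hpos g (by simpa using hg)
      rwa [← hL] at this)
    (by
      intro y
      refine ⟨⟨Φ (‖y‖ • e), _, rfl⟩, ?_⟩
      simp only [PointedCone.mem_positive, map_smul, hΦ]
      intro k
      have := neg_le_of_abs_le (y.norm_coe_le_norm k)
      change 0 ≤ ‖y‖ * 1 + y k
      linarith)
  have hMΛ (g : E) : M (Φ g) = Λ g := by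
    rw [← hL]
    exact hMΦ ⟨Φ g, g, rfl⟩
  let Λ' : CompactlySupportedContinuousMap K ℝ →ₚ[ℝ] ℝ :=
    { toFun := fun g ↦ M g.toContinuousMap
      map_add' := fun g h ↦ M.map_add _ _
      map_smul' := fun c g ↦ M.map_smul _ _
      monotone' := fun g h hgh ↦ by
        have := hM (h.toContinuousMap - g.toContinuousMap) (by
          rw [PointedCone.mem_positive, sub_nonneg]; exact hgh)
        rwa [map_sub, sub_nonneg] at this }
  have hint (g : E) : ∫ k, Φ g k ∂(RealRMK.rieszMeasure Λ') = Λ g :=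
    (RealRMK.integral_rieszMeasure Λ'
      (CompactlySupportedContinuousMap.continuousMapEquiv (Φ g))).trans (hMΛ g)
  refine ⟨RealRMK.rieszMeasure Λ', ?_, hint⟩
  have h1 := hint e
  rw [isProbabilityMeasure_iff_real]
  simpa [hΦ, hΛ] using h1

theorem Finset.exists_card_le_finrank_add_one_sum_smul_eq {ι V : Type*} [AddCommGroup V]
    [Module ℝ V] [FiniteDimensional ℝ V] (φ : ι → V) (g : ι → ℝ) (s : Finset ι) (t : ι → ℝ)
    (ht : ∀ i ∈ s, 0 ≤ t i) :
    ∃ s' ⊆ s, s'.card ≤ Module.finrank ℝ V + 1 ∧ ∃ t' : ι → ℝ, (∀ i ∈ s', 0 ≤ t' i) ∧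
      ∑ i ∈ s', t' i = ∑ i ∈ s, t i ∧ ∑ i ∈ s', t' i • φ i = ∑ i ∈ s, t i • φ i ∧
      ∑ i ∈ s', t' i * g i ≤ ∑ i ∈ s, t i * g i := by
  classical
  induction s using Finset.strongInduction generalizing t with
  | H s ih =>
    by_cases hs : s.card ≤ Module.finrank ℝ V + 1
    · exact ⟨s, subset_rfl, hs, t, ht, rfl, rfl, le_rfl⟩
    obtain ⟨c, hcφ, hc1, hcg, hneg⟩ : ∃ c : ι → ℝ, ∑ i ∈ s, c i • φ i = 0 ∧ ∑ i ∈ s, c i = 0 ∧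
        ∑ i ∈ s, c i * g i ≤ 0 ∧ ∃ i ∈ s, c i < 0 := by
      have hdep : ¬ LinearIndepOn ℝ (fun i ↦ ((φ i, 1) : V × ℝ)) s := fun h ↦ by
        have := LinearIndependent.fintype_card_le_finrank h
        simp at this
        omega
      rw [not_linearIndepOn_finset_iff] at hdep
      obtain ⟨c, hc, i, hi, hci⟩ := hdep
      have hcφ : ∑ i ∈ s, c i • φ i = 0 := by simpa [Prod.fst_sum] using congrArg Prod.fst hc
      have hc1 : ∑ i ∈ s, c i = 0 := by simpa [Prod.snd_sum] using congrArg Prod.snd hc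
      have hneg : ∃ i ∈ s, c i < 0 := by
        by_contra! h
        exact hci ((Finset.sum_eq_zero_iff_of_nonneg h).1 hc1 i hi)
      have hposc : ∃ i ∈ s, 0 < c i := by
        by_contra! h
        exact hci ((Finset.sum_eq_zero_iff_of_nonpos h).1 hc1 i hi)
      rcases le_total (∑ i ∈ s, c i * g i) 0 with h | h
      · exact ⟨c, hcφ, hc1, h, hneg⟩
      · exact ⟨-c, by simpa using hcφ, by simpa using hc1, by simpa using h, by simpa using hposc⟩
    obtain ⟨i₀, hi₀, hmin⟩ := (s.filter (c · < 0)).exists_min_image (fun i ↦ t i / (-c i))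
      (by obtain ⟨i, hi, h⟩ := hneg; exact ⟨i, by simp [hi, h]⟩)
    rw [Finset.mem_filter] at hi₀
    set a := t i₀ / (-c i₀) with ha
    have ha0 : 0 ≤ a := div_nonneg (ht _ hi₀.1) (by linarith [hi₀.2])
    let u : ι → ℝ := fun i ↦ t i + a * c i
    have hu0 : u i₀ = 0 := by
      have := hi₀.2.ne
      simp only [u, ha]
      field_simp
      ring
    have hu (i) (hi : i ∈ s) : 0 ≤ u i := by
      rcases lt_or_ge (c i) 0 with h | h
      · have := hmin i (by simp [hi, h])
        rw [le_div_iff₀ (by linarith)] at this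
        simp only [u]; linarith
      · have := mul_nonneg ha0 h
        have := ht i hi
        simp only [u]; linarith
    obtain ⟨s', hs', hcard, t', h1, h2, h3, h4⟩ := ih (s.erase i₀) (Finset.erase_ssubset hi₀.1) u
      (fun i hi ↦ hu i (Finset.mem_of_mem_erase hi))
    refine ⟨s', hs'.trans (Finset.erase_subset _ _), hcard, t', h1, h2.trans ?_, h3.trans ?_,
      h4.trans ?_⟩
    · rw [Finset.sum_erase _ hu0]
      simp [u, Finset.sum_add_distrib, ← Finset.mul_sum, hc1]
    · rw [Finset.sum_erase _ (by simp [hu0])]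
      simp [u, Finset.sum_add_distrib, add_smul, mul_smul, ← Finset.smul_sum, hcφ]
    · rw [Finset.sum_erase _ (by simp [hu0])]
      simp only [u, add_mul, mul_assoc, Finset.sum_add_distrib, ← Finset.mul_sum]
      linarith [mul_nonpos_of_nonneg_of_nonpos ha0 hcg]

theorem exists_stdSimplex_fin_sum_smul_eq {ι X V : Type*} [Fintype ι] [AddCommGroup V] [Module ℝ V]
    [FiniteDimensional ℝ V] (φ : X → V) (g : X → ℝ) {t : ι → ℝ} (ht : t ∈ stdSimplex ℝ ι)
    (x : ι → X) :
    ∃ (y : Fin (Module.finrank ℝ V + 1) → X), ∃ u ∈ stdSimplex ℝ (Fin (Module.finrank ℝ V + 1)),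
      ∑ j, u j • φ (y j) = ∑ i, t i • φ (x i) ∧ ∑ j, u j * g (y j) ≤ ∑ i, t i * g (x i) := by
  obtain ⟨s, -, hcard, t', ht0, ht1, htφ, htg⟩ :=
    Finset.exists_card_le_finrank_add_one_sum_smul_eq (φ ∘ x) (g ∘ x) Finset.univ t
      (fun i _ ↦ ht.1 i)
  obtain ⟨i₀⟩ : Nonempty ι := by
    by_contra h
    rw [not_nonempty_iff] at h
    simpa using ht.2
  obtain ⟨e⟩ : Nonempty (s ↪ Fin (Module.finrank ℝ V + 1)) :=
    Function.Embedding.nonempty_of_card_le (by simpa using hcard)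
  let u := Function.extend e (fun i ↦ t' i) 0
  let y := Function.extend e (fun i ↦ x i) (fun _ ↦ x i₀)
  have hu (i : s) : u (e i) = t' i := e.injective.extend_apply _ _ _
  have hy (i : s) : y (e i) = x i := e.injective.extend_apply _ _ _
  have hu' (j) (hj : j ∉ Set.range e) : u j = 0 := Function.extend_apply' _ _ _ hj
  refine ⟨y, u, ⟨fun j ↦ ?_, ?_⟩, ?_, ?_⟩
  · by_cases hj : j ∈ Set.range e
    · obtain ⟨i, rfl⟩ := hj
      exact (hu i).symm ▸ ht0 i i.2
    · exact (hu' j hj).ge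
  · rw [← Fintype.sum_of_injective e e.injective (fun i ↦ t' i) u hu' (fun i ↦ (hu i).symm),
      Finset.sum_coe_sort s t', ht1, ht.2]
  · rw [← Fintype.sum_of_injective e e.injective (fun i ↦ t' i • φ (x i)) _
      (fun j hj ↦ by simp [hu' j hj]) (fun i ↦ by rw [hu, hy]),
      Finset.sum_coe_sort s (fun i ↦ t' i • φ (x i))]
    exact htφ
  · rw [← Fintype.sum_of_injective e e.injective (fun i ↦ t' i * g (x i)) _
      (fun j hj ↦ by simp [hu' j hj]) (fun i ↦ by rw [hu, hy]),
      Finset.sum_coe_sort s (fun i ↦ t' i * g (x i))]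
    exact htg

theorem exists_stdSimplex_fin_sum_smul_eq_integral {X V : Type*} [TopologicalSpace X]
    [CompactSpace X] [MeasurableSpace X] [BorelSpace X] [NormedAddCommGroup V]
    [NormedSpace ℝ V] [FiniteDimensional ℝ V] (μ : Measure X) [IsProbabilityMeasure μ]
    (φ : C(X, V)) (g : C(X, ℝ)) :
    ∃ (y : Fin (Module.finrank ℝ V + 1) → X), ∃ u ∈ stdSimplex ℝ (Fin (Module.finrank ℝ V + 1)),
      ∑ j, u j • φ (y j) = ∫ x, φ x ∂μ ∧ ∑ j, u j * g (y j) ≤ ∫ x, g x ∂μ := by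
  have : CompleteSpace V := FiniteDimensional.complete ℝ V
  let n := Module.finrank ℝ V + 1
  let C : Set (V × ℝ) := {q | ∃ (y : Fin n → X), ∃ u ∈ stdSimplex ℝ (Fin n),
    ∑ j, u j • φ (y j) = q.1 ∧ ∑ j, u j * g (y j) ≤ q.2}
  have hclosed : IsClosed C := by
    have hC : C = Prod.fst '' {p : (V × ℝ) × (Fin n → X) × stdSimplex ℝ (Fin n) |
        ∑ j, p.2.2.1 j • φ (p.2.1 j) = p.1.1 ∧ ∑ j, p.2.2.1 j * g (p.2.1 j) ≤ p.1.2} := by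
      ext q
      constructor
      · rintro ⟨y, u, hu, h⟩
        exact ⟨(q, y, ⟨u, hu⟩), h, rfl⟩
      · rintro ⟨⟨q, y, u⟩, h, rfl⟩
        exact ⟨y, u.1, u.2, h⟩
    rw [hC]
    have hu (j : Fin n) : Continuous
        fun p : (V × ℝ) × (Fin n → X) × stdSimplex ℝ (Fin n) ↦ p.2.2.1 j :=
      (continuous_apply j).comp (continuous_subtype_val.comp (by fun_prop))
    exact isClosedMap_fst_of_compactSpace _ <| IsClosed.inter
      (isClosed_eq (continuous_finsetSum _ fun j _ ↦ (hu j).smul (by fun_prop)) (by fun_prop))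
      (isClosed_le (continuous_finsetSum _ fun j _ ↦ (hu j).mul (by fun_prop)) (by fun_prop))
  have hconvex : Convex ℝ C := by
    rintro ⟨v, r⟩ ⟨y, u, hu, hφ, hg⟩ ⟨v', r'⟩ ⟨y', u', hu', hφ', hg'⟩ a b ha hb hab
    dsimp only at hφ hg hφ' hg'
    obtain ⟨z, c, hc, hcφ, hcg⟩ := exists_stdSimplex_fin_sum_smul_eq φ g
      (t := Sum.elim (a • u) (b • u')) ⟨by
        rintro (j | j)
        · exact mul_nonneg ha (hu.1 j)
        · exact mul_nonneg hb (hu'.1 j), by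
        simp [← Finset.mul_sum, hu.2, hu'.2, hab]⟩ (Sum.elim y y')
    refine ⟨z, c, hc, hcφ.trans ?_, hcg.trans ?_⟩
    · simp [mul_smul, ← Finset.smul_sum, hφ, hφ']
    · simp only [Fintype.sum_sum_type, Sum.elim_inl, Sum.elim_inr, Pi.smul_apply, smul_eq_mul,
        mul_assoc, ← Finset.mul_sum, Prod.smul_mk, Prod.mk_add_mk]
      gcongr
  have hmem (x : X) : (φ x, g x) ∈ C := by
    refine ⟨fun _ ↦ x, Pi.single 0 1, single_mem_stdSimplex ℝ 0, ?_, ?_⟩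
    · simp [← Finset.sum_smul]
    · simp [← Finset.sum_mul]
  have hφ : Integrable φ μ :=
    φ.continuous.integrable_of_hasCompactSupport (HasCompactSupport.of_compactSpace _)
  have hg : Integrable g μ :=
    g.continuous.integrable_of_hasCompactSupport (HasCompactSupport.of_compactSpace _)
  have := hconvex.integral_mem (μ := μ) hclosed (.of_forall hmem) (hφ.prodMk hg)
  rwa [integral_pair hφ hg] at this

/-- Three weighted points on the circle, the weights forming a probability vector with
barycentre `0`. -/
def WeightedTriple : Set ((Fin 3 → UnitCircle) × (Fin 3 → ℝ)) :=
  {p | p.2 ∈ stdSimplex ℝ (Fin 3) ∧ ∑ i, p.2 i • (p.1 i : ℂ) = 0}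

namespace WeightedTriple

theorem isCompact : IsCompact WeightedTriple := by
  have h : WeightedTriple = (Set.univ ×ˢ stdSimplex ℝ (Fin 3)) ∩
      {p : (Fin 3 → UnitCircle) × (Fin 3 → ℝ) | ∑ i, p.2 i • (p.1 i : ℂ) = 0} := by
    ext p
    simp [WeightedTriple]
  rw [h]
  exact (isCompact_univ.prod (isCompact_stdSimplex ℝ (Fin 3))).inter_right
    (isClosed_eq (by fun_prop) continuous_const)

instance : CompactSpace WeightedTriple := isCompact_iff_compactSpace.1 isCompact

/-- The measure on the circle carried by a weighted triple. -/
noncomputable def toMeasure (p : WeightedTriple) : Measure UnitCircle :=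
  ∑ i, ENNReal.ofReal (p.1.2 i) • Measure.dirac (p.1.1 i)

theorem measurable_toMeasure : Measurable toMeasure := by
  refine Measure.measurable_of_measurable_coe _ fun s hs ↦ ?_
  simp only [toMeasure, Measure.finsetSum_apply, Measure.smul_apply, smul_eq_mul,
    Measure.dirac_apply' _ hs]
  refine Finset.measurable_sum _ fun i _ ↦ Measurable.mul (by fun_prop) ?_
  exact (measurable_one.indicator hs).comp (by fun_prop)

theorem integral_toMeasure {E : Type*} [NormedAddCommGroup E] [NormedSpace ℝ E] [CompleteSpace E]
    (p : WeightedTriple) (g : C(UnitCircle, E)) :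
    ∫ w, g w ∂toMeasure p = ∑ i, p.1.2 i • g (p.1.1 i) := by
  rw [toMeasure, integral_finsetSum_measure]
  · refine Finset.sum_congr rfl fun i _ ↦ ?_
    rw [integral_smul_measure, integral_dirac, ENNReal.toReal_ofReal (p.2.1.1 i)]
  · intro i _
    exact (integrable_dirac (by finiteness)).smul_measure ENNReal.ofReal_ne_top

instance (p : WeightedTriple) : IsProbabilityMeasure (toMeasure p) := by
  constructor
  simp [toMeasure, ← ENNReal.ofReal_sum_of_nonneg (fun i _ ↦ p.2.1.1 i), p.2.1.2]

theorem toMeasure_mem_thetaHat (p : WeightedTriple) : toMeasure p ∈ ThetaHat := by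
  classical
  refine ⟨inferInstance, ?_, Finset.univ.image p.1.1, Finset.card_image_le, ?_⟩
  · exact (integral_toMeasure p ⟨fun w ↦ (w : ℂ), by fun_prop⟩).trans p.2.2
  · simp [toMeasure]

theorem exists_isProbabilityMeasure_integral_eq (μ : Measure UnitCircle) [IsProbabilityMeasure μ]
    (hμ : ∫ w : UnitCircle, (w : ℂ) ∂μ = 0) :
    ∃ P : Measure WeightedTriple, IsProbabilityMeasure P ∧
      ∀ g : C(UnitCircle, ℝ), ∫ p : WeightedTriple, (∫ w, g w ∂toMeasure p) ∂P = ∫ w, g w ∂μ := by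
  let Φ : C(UnitCircle, ℝ) →ₗ[ℝ] C(WeightedTriple, ℝ) :=
    { toFun := fun g ↦ ⟨fun p ↦ ∑ i, p.1.2 i • g (p.1.1 i), by fun_prop⟩
      map_add' := fun g h ↦ by
        ext p
        simp [mul_add, Finset.sum_add_distrib]
      map_smul' := fun c g ↦ by
        ext p
        simp [mul_left_comm, Finset.mul_sum] }
  have hint (g : C(UnitCircle, ℝ)) : Integrable g μ :=
    g.continuous.integrable_of_hasCompactSupport (HasCompactSupport.of_compactSpace _)
  let Λ : C(UnitCircle, ℝ) →ₗ[ℝ] ℝ :=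
    { toFun := fun g ↦ ∫ w, g w ∂μ
      map_add' := fun g h ↦ integral_add (hint g) (hint h)
      map_smul' := fun c g ↦ integral_smul c _ }
  obtain ⟨P, hP, h⟩ := _root_.exists_isProbabilityMeasure_integral_eq Φ Λ 1
    (by ext p; simpa [Φ] using p.2.1.2) (by simp [Λ]) fun g hg ↦ by
      have key := exists_stdSimplex_fin_sum_smul_eq_integral μ
        ⟨fun w : UnitCircle ↦ (w : ℂ), by fun_prop⟩ g
      rw [Complex.finrank_real_complex] at key
      obtain ⟨y, u, hu, h0, hle⟩ := key
      exact (hg ⟨(y, u), hu, h0.trans hμ⟩).trans hle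
  refine ⟨P, hP, fun g ↦ ?_⟩
  simp_rw [integral_toMeasure]
  exact h g

end WeightedTriple

theorem exists_measurable_eq_integral {X : Type*} [TopologicalSpace X] [CompactSpace X]
    [MeasurableSpace X] [BorelSpace X] (g : C(X, ℂ)) :
    ∃ G : Measure X → ℂ, Measurable G ∧
      ∀ ϑ : Measure X, IsFiniteMeasure ϑ → ∫ x, g x ∂ϑ = G ϑ := by
  have hreal (h : C(X, ℝ)) : ∃ H : Measure X → ℝ, Measurable H ∧
      ∀ ϑ : Measure X, IsFiniteMeasure ϑ → ∫ x, h x ∂ϑ = H ϑ := by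
    refine ⟨fun ϑ ↦ (∫⁻ x, ENNReal.ofReal (h x) ∂ϑ).toReal -
      (∫⁻ x, ENNReal.ofReal (-h x) ∂ϑ).toReal, ?_, fun ϑ _ ↦ ?_⟩
    · exact (Measure.measurable_lintegral (by fun_prop)).ennreal_toReal.sub
        (Measure.measurable_lintegral (by fun_prop)).ennreal_toReal
    · exact integral_eq_lintegral_pos_part_sub_lintegral_neg_part
        (h.continuous.integrable_of_hasCompactSupport (HasCompactSupport.of_compactSpace _))
  obtain ⟨R, hR, hgR⟩ := hreal ⟨fun x ↦ (g x).re, by fun_prop⟩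
  obtain ⟨J, hJ, hgJ⟩ := hreal ⟨fun x ↦ (g x).im, by fun_prop⟩
  refine ⟨fun ϑ ↦ R ϑ + J ϑ * I, by fun_prop, fun ϑ _ ↦ ?_⟩
  have hg : Integrable g ϑ :=
    g.continuous.integrable_of_hasCompactSupport (HasCompactSupport.of_compactSpace _)
  beta_reduce
  rw [← hgR ϑ inferInstance, ← hgJ ϑ inferInstance]
  exact (integral_re_add_im hg).symm

theorem exists_finset_card_le_measure_compl_eq_zero_iff {X : Type*} [TopologicalSpace X]
    [T2Space X] [SecondCountableTopology X] [MeasurableSpace X] (ϑ : Measure X) (n : ℕ) :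
    (∃ S : Finset X, S.card ≤ n ∧ ϑ (↑S)ᶜ = 0) ↔
      ∀ B : Fin (n + 1) → TopologicalSpace.countableBasis X,
        Pairwise (Function.onFun Disjoint fun i ↦ (B i : Set X)) → ∃ i, ϑ (B i) = 0 := by
  constructor
  · rintro ⟨S, hS, hϑ⟩ B hB
    by_contra! h
    have hmem (i) : ∃ x ∈ S, x ∈ (B i : Set X) := by
      by_contra! hi
      exact h i (measure_mono_null (fun x hx hxS ↦ hi x hxS hx) hϑ)
    choose x hxS hxB using hmem
    have hx : Function.Injective x := fun i j hij ↦ by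
      by_contra hne
      exact Set.disjoint_left.1 (hB hne) (hxB i) (hij ▸ hxB j)
    have := Finset.card_le_card_of_injOn x (s := Finset.univ) (t := S) (by simpa using hxS) hx.injOn
    simp at this
    omega
  · intro h
    have hle : ϑ.support.encard ≤ n := by
      by_contra! hlt
      obtain ⟨T, hT, hTcard⟩ := Set.exists_subset_encard_eq (k := ((n + 1 : ℕ) : ℕ∞))
        (s := ϑ.support) (by push_cast; exact Order.add_one_le_of_lt hlt)
      have hTfin : T.Finite := Set.finite_of_encard_eq_coe hTcard
      obtain ⟨U, hU, hdisj⟩ := hTfin.t2_separation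
      have hT' : T.ncard = n + 1 := by simp [Set.ncard, hTcard]
      have := hTfin.to_subtype
      let e : Fin (n + 1) ≃ T := (finCongr hT'.symm).trans (Finite.equivFin T).symm
      have hB (i : Fin (n + 1)) :=
        (TopologicalSpace.isBasis_countableBasis X).exists_subset_of_mem_open
          (hU (e i)).1 (hU (e i)).2
      choose B hBmem heB hBU using hB
      obtain ⟨i, hi⟩ := h (fun i ↦ ⟨B i, hBmem i⟩) fun i j hij ↦
        (hdisj (e i).2 (e j).2 fun h ↦ hij (e.injective (Subtype.ext h))).mono (hBU i) (hBU j)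
      have := (Measure.mem_support_iff_forall _).1 (hT (e i).2) (B i)
        ((TopologicalSpace.isOpen_of_mem_countableBasis (hBmem i)).mem_nhds (heB i))
      exact this.ne' hi
    have hfin : ϑ.support.Finite := Set.finite_of_encard_le_coe hle
    refine ⟨hfin.toFinset, ?_, by simp⟩
    rw [hfin.encard_eq_coe_toFinset_card] at hle
    exact_mod_cast hle

theorem measurableSet_thetaHat : MeasurableSet ThetaHat := by
  obtain ⟨G, hG, hGint⟩ := exists_measurable_eq_integral
    (⟨fun w ↦ (w : ℂ), by fun_prop⟩ : C(UnitCircle, ℂ))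
  have h : ThetaHat = {ϑ | ϑ Set.univ = 1} ∩ {ϑ | G ϑ = 0} ∩
      ⋂ B : Fin 4 → TopologicalSpace.countableBasis UnitCircle,
        ⋂ _ : Pairwise (Function.onFun Disjoint fun i ↦ (B i : Set UnitCircle)),
          ⋃ i, {ϑ | ϑ (B i) = 0} := by
    ext ϑ
    simp only [ThetaHat, Set.mem_ofPred_eq, Set.mem_inter_iff, Set.mem_iInter, Set.mem_iUnion,
      exists_finset_card_le_measure_compl_eq_zero_iff, isProbabilityMeasure_iff, and_assoc]
    refine and_congr_right fun h1 ↦ and_congr_left fun _ ↦ ?_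
    have : IsProbabilityMeasure ϑ := ⟨h1⟩
    rw [← hGint ϑ inferInstance]
    rfl
  rw [h]
  refine ((measurableSet_eq_fun (Measure.measurable_coe .univ) measurable_const).inter
    (measurableSet_eq_fun hG measurable_const)).inter <|
    .iInter fun B ↦ .iInter fun _ ↦ .iUnion fun i ↦ ?_
  exact measurableSet_eq_fun (Measure.measurable_coe
    (TopologicalSpace.isOpen_of_mem_countableBasis (B i).2).measurableSet) measurable_const

section Herglotz

open Metric Filter
open scoped Topology ComplexConjugate

theorem circleAverage_herglotz_mul {F : ℂ → ℂ} (hF : DiffContOnCl ℂ F (ball 0 1)) {z : ℂ}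
    (hz : z ∈ ball (0 : ℂ) 1) :
    Real.circleAverage (fun w ↦ (w + z) / (w - z) * F w) 0 1 = 2 * F z - F 0 := by
  have hc : ContinuousOn F (sphere 0 |1|) := by
    rw [abs_one]
    exact hF.continuousOn_ball.mono sphere_subset_closedBall
  have hne : ∀ w ∈ sphere (0 : ℂ) |1|, w - z ≠ 0 := by
    intro w hw h
    rw [sub_eq_zero] at h
    simp_all
  have h1 : CircleIntegrable (fun w ↦ (2 : ℂ) • (((w - 0) / (w - z)) • F w)) 0 1 := by
    refine ContinuousOn.circleIntegrable' ?_
    simp only [smul_eq_mul]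
    fun_prop (disch := assumption)
  have h2 : CircleIntegrable F 0 1 := hc.circleIntegrable'
  rw [Real.circleAverage_congr_sphere (f₂ := fun w ↦ (2 : ℂ) • (((w - 0) / (w - z)) • F w) - F w),
    Real.circleAverage_fun_sub h1 h2, Real.circleAverage_fun_smul,
    DiffContOnCl.circleAverage_smul_div (by simpa using hF) (by simpa using hz),
    DiffContOnCl.circleAverage (by simpa using hF)]
  · simp
  · intro w hw
    have := hne w hw
    simp only [smul_eq_mul]
    field_simp
    ring

theorem circleAverage_herglotz_mul_conj {F : ℂ → ℂ} (hF : DiffContOnCl ℂ F (ball 0 1)) {z : ℂ}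
    (hz : z ∈ ball (0 : ℂ) 1) :
    Real.circleAverage (fun w ↦ (w + z) / (w - z) * conj (F w)) 0 1 = conj (F 0) := by
  have hne : ∀ w ∈ closedBall (0 : ℂ) 1, 1 - conj z * w ≠ 0 := by
    intro w hw h
    have h1 : ‖conj z * w‖ = 1 := by rw [← sub_eq_zero.1 h, norm_one]
    rw [norm_mul, RCLike.norm_conj] at h1
    simp at hw hz
    nlinarith [norm_nonneg w, norm_nonneg z]
  have hd : DiffContOnCl ℂ (fun w ↦ (1 + conj z * w) / (1 - conj z * w) * F w) (ball 0 1) := by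
    refine DiffContOnCl.smul (𝕜' := ℂ) (F := ℂ)
      (c := fun w ↦ (1 + conj z * w) / (1 - conj z * w)) (DifferentiableOn.diffContOnCl ?_) hF
    rw [closure_ball _ one_ne_zero]
    fun_prop (disch := assumption)
  have hi : CircleIntegrable (fun w ↦ (1 + conj z * w) / (1 - conj z * w) * F w) 0 1 :=
    (hd.continuousOn_ball.mono sphere_subset_closedBall).circleIntegrable zero_le_one
  rw [Real.circleAverage_congr_sphere
      (f₂ := (conjCLE : ℂ →L[ℝ] ℂ) ∘ fun w ↦ (1 + conj z * w) / (1 - conj z * w) * F w),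
    ContinuousLinearMap.circleAverage_comp_comm _ hi,
    DiffContOnCl.circleAverage (by simpa only [abs_one] using hd)]
  · simp
  · intro w hw
    have hw1 : conj w * w = 1 := by simp_all [conj_mul']
    have hw0 : conj w ≠ 0 := left_ne_zero_of_mul_eq_one hw1
    simp only [Function.comp_apply, ContinuousLinearEquiv.coe_coe, conjCLE_apply, map_mul,
      map_div₀, map_add, map_sub, map_one, conj_conj]
    rw [← mul_div_mul_left (w + z) (w - z) hw0, mul_add, mul_sub, hw1, mul_comm z]

theorem circleAverage_herglotz_mul_re {F : ℂ → ℂ} (hF : DiffContOnCl ℂ F (ball 0 1))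
    (hF0 : (F 0).im = 0) {z : ℂ} (hz : z ∈ ball (0 : ℂ) 1) :
    Real.circleAverage (fun w ↦ (w + z) / (w - z) * (F w).re) 0 1 = F z := by
  have hc : ContinuousOn F (sphere 0 1) := hF.continuousOn_ball.mono sphere_subset_closedBall
  have hne : ∀ w ∈ sphere (0 : ℂ) 1, w - z ≠ 0 := by
    intro w hw h
    rw [sub_eq_zero] at h
    simp_all
  have h1 : CircleIntegrable (fun w ↦ (w + z) / (w - z) * F w) 0 1 :=
    ContinuousOn.circleIntegrable zero_le_one (by fun_prop (disch := assumption))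
  have h2 : CircleIntegrable (fun w ↦ (w + z) / (w - z) * conj (F w)) 0 1 :=
    ContinuousOn.circleIntegrable zero_le_one (by fun_prop (disch := assumption))
  calc
    _ = Real.circleAverage (fun w ↦ (2⁻¹ : ℂ) • ((w + z) / (w - z) * F w +
          (w + z) / (w - z) * conj (F w))) 0 1 := by
      congr! 2 with w
      rw [re_eq_add_conj, smul_eq_mul]
      ring
    _ = F z := by
      rw [Real.circleAverage_fun_smul, Real.circleAverage_fun_add h1 h2,
        circleAverage_herglotz_mul hF hz, circleAverage_herglotz_mul_conj hF hz,
        conj_eq_iff_im.2 hF0, smul_eq_mul]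
      ring

theorem exists_probabilityMeasure_integral_eq_circleAverage {u : ℂ → ℝ}
    (hu : ContinuousOn u (sphere 0 1)) (hpos : ∀ w ∈ sphere (0 : ℂ) 1, 0 ≤ u w)
    (hu1 : Real.circleAverage u 0 1 = 1) :
    ∃ μ : ProbabilityMeasure UnitCircle, ∀ g : ℂ → ℂ, ContinuousOn g (sphere 0 1) →
      ∫ w, g w ∂(μ : Measure UnitCircle) = Real.circleAverage (fun w ↦ g w * u w) 0 1 := by
  let e : ℝ → UnitCircle := fun θ ↦ ⟨circleMap 0 1 θ, circleMap_mem_sphere 0 zero_le_one θ⟩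
  have he : Continuous e := by fun_prop
  have huc : Continuous fun θ ↦ u (e θ) := hu.comp_continuous (by fun_prop) fun θ ↦ (e θ).2
  have hpos' (θ : ℝ) : 0 ≤ (2 * Real.pi)⁻¹ * u (e θ) :=
    mul_nonneg (by positivity) (hpos _ (e θ).2)
  let μ₀ : Measure ℝ := (volume.restrict (Set.Ioc 0 (2 * Real.pi))).withDensity
    fun θ ↦ ENNReal.ofReal ((2 * Real.pi)⁻¹ * u (e θ))
  have hμ₀ : IsProbabilityMeasure μ₀ := by
    refine ⟨?_⟩
    rw [withDensity_apply _ .univ, Measure.restrict_univ,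
      ← ofReal_integral_eq_lintegral_ofReal (((huc.const_mul _).integrableOn_Icc).mono_set
        Set.Ioc_subset_Icc_self) (.of_forall hpos'), integral_const_mul,
      ← intervalIntegral.integral_of_le Real.two_pi_pos.le, ← smul_eq_mul]
    change ENNReal.ofReal (Real.circleAverage u 0 1) = 1
    rw [hu1, ENNReal.ofReal_one]
  refine ⟨⟨μ₀.map e, Measure.isProbabilityMeasure_map he.aemeasurable⟩, fun g hg ↦ ?_⟩
  have hg' : Continuous fun w : UnitCircle ↦ g w := hg.domRestrict
  change ∫ w : UnitCircle, g w ∂(μ₀.map e) = _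
  rw [integral_map he.aemeasurable hg'.aestronglyMeasurable,
    integral_withDensity_eq_integral_toReal_smul (huc.const_mul _).measurable.ennreal_ofReal
      (by simp), Real.circleAverage, intervalIntegral.integral_of_le Real.two_pi_pos.le,
    ← integral_smul]
  refine integral_congr_ae (.of_forall fun θ ↦ ?_)
  simp only
  rw [ENNReal.toReal_ofReal (hpos' θ)]
  simp only [e, real_smul, ofReal_mul]
  ring

theorem continuous_herglotz {z : ℂ} (hz : z ∈ ball (0 : ℂ) 1) :
    Continuous fun w : UnitCircle ↦ ((w : ℂ) + z) / ((w : ℂ) - z) := by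
  have (w : UnitCircle) : (w : ℂ) - z ≠ 0 := by
    intro h
    have := w.2
    rw [sub_eq_zero.1 h] at this
    simp_all
  fun_prop (disch := assumption)

theorem exists_probabilityMeasure_integral_herglotz_eq_comp_mul {f : ℂ → ℂ}
    (hf : DifferentiableOn ℂ f (ball 0 1)) (hre : ∀ z ∈ ball (0 : ℂ) 1, 0 ≤ (f z).re)
    (h0 : f 0 = 1) {r : ℝ} (hr0 : 0 ≤ r) (hr1 : r < 1) :
    ∃ μ : ProbabilityMeasure UnitCircle, ∀ z ∈ ball (0 : ℂ) 1,
      ∫ w : UnitCircle, ((w : ℂ) + z) / ((w : ℂ) - z) ∂(μ : Measure UnitCircle) = f (r * z) := by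
  have hmaps : Set.MapsTo (fun z : ℂ ↦ r * z) (closedBall 0 1) (ball 0 1) := by
    intro z hz
    simp only [mem_closedBall, mem_ball, dist_zero_right, norm_mul, norm_real,
      Real.norm_of_nonneg hr0] at hz ⊢
    nlinarith [norm_nonneg z]
  have hF : DiffContOnCl ℂ (fun z ↦ f (r * z)) (ball 0 1) := by
    refine DifferentiableOn.diffContOnCl ?_
    rw [closure_ball _ one_ne_zero]
    exact hf.comp (by fun_prop) hmaps
  have hc : ContinuousOn (fun z ↦ f (r * z)) (sphere 0 1) :=
    hF.continuousOn_ball.mono sphere_subset_closedBall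
  have havg : Real.circleAverage (fun w ↦ (f (r * w)).re) 0 1 = 1 := by
    have := reCLM.circleAverage_comp_comm (hc.circleIntegrable zero_le_one)
    rw [DiffContOnCl.circleAverage (by simpa using hF)] at this
    simpa [Function.comp_def, h0] using this
  obtain ⟨μ, hμ⟩ := exists_probabilityMeasure_integral_eq_circleAverage
    (u := fun w ↦ (f (r * w)).re) (continuous_re.comp_continuousOn hc)
    (fun w hw ↦ hre _ (hmaps (sphere_subset_closedBall hw))) havg
  refine ⟨μ, fun z hz ↦ ?_⟩
  rw [hμ (fun w ↦ (w + z) / (w - z))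
    (continuousOn_iff_continuous_domRestrict.2 (continuous_herglotz hz))]
  exact circleAverage_herglotz_mul_re hF (by simp [h0]) hz

theorem exists_isProbabilityMeasure_integral_herglotz_eq {f : ℂ → ℂ}
    (hf : DifferentiableOn ℂ f (ball 0 1)) (hre : ∀ z ∈ ball (0 : ℂ) 1, 0 ≤ (f z).re)
    (h0 : f 0 = 1) :
    ∃ μ : Measure UnitCircle, IsProbabilityMeasure μ ∧ ∀ z ∈ ball (0 : ℂ) 1,
      ∫ w : UnitCircle, ((w : ℂ) + z) / ((w : ℂ) - z) ∂μ = f z := by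
  have : Nonempty (ProbabilityMeasure UnitCircle) :=
    ⟨(exists_probabilityMeasure_integral_herglotz_eq_comp_mul hf hre h0 le_rfl one_pos).choose⟩
  choose! μ hμ using fun r : ℝ ↦ fun hr : 0 ≤ r ∧ r < 1 ↦
    exists_probabilityMeasure_integral_herglotz_eq_comp_mul hf hre h0 hr.1 hr.2
  have hev : ∀ᶠ r : ℝ in 𝓝[<] 1, 0 ≤ r ∧ r < 1 := by
    filter_upwards [Ioo_mem_nhdsLT one_pos] with r hr using ⟨hr.1.le, hr.2⟩
  let 𝒰 := Ultrafilter.of (𝓝[<] (1 : ℝ))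
  have h𝒰 : (𝒰 : Filter ℝ) ≤ 𝓝[<] 1 := Ultrafilter.of_le _
  obtain ⟨μ', -, hμ'⟩ := isCompact_univ.ultrafilter_le_nhds (𝒰.map μ) (by simp)
  have htend : Tendsto μ 𝒰 (𝓝 μ') := hμ'
  refine ⟨μ', inferInstance, fun z hz ↦ ?_⟩
  have h1 := (ProbabilityMeasure.tendsto_iff_forall_integral_rclike_tendsto ℂ).1 htend
    (BoundedContinuousFunction.mkOfCompact ⟨_, continuous_herglotz hz⟩)
  have hcont : Tendsto (fun r : ℝ ↦ f (r * z)) (𝓝 1) (𝓝 (f z)) := by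
    have hz' : ContinuousAt f (((1 : ℝ) : ℂ) * z) := by
      rw [ofReal_one, one_mul]
      exact (hf.differentiableAt (isOpen_ball.mem_nhds hz)).continuousAt
    have := ContinuousAt.comp' (f := fun r : ℝ ↦ (r : ℂ) * z) hz' (by fun_prop)
    simpa [ContinuousAt] using this
  refine tendsto_nhds_unique h1 (((hcont.mono_left nhdsWithin_le_nhds).mono_left h𝒰).congr' ?_)
  filter_upwards [h𝒰 hev] with r hr using (hμ r hr z hz).symm

theorem integral_coe_eq_zero_of_integral_herglotz_eq {f : ℂ → ℂ} {μ : Measure UnitCircle}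
    [IsProbabilityMeasure μ] (hf : DifferentiableAt ℂ f 0) (hf' : deriv f 0 = 0)
    (hμ : ∀ z ∈ ball (0 : ℂ) 1, ∫ w : UnitCircle, ((w : ℂ) + z) / ((w : ℂ) - z) ∂μ = f z) :
    ∫ w : UnitCircle, (w : ℂ) ∂μ = 0 := by
  have hne (w : UnitCircle) : (w : ℂ) ≠ 0 := ne_of_mem_sphere w.2 one_ne_zero
  have h0 : f 0 = 1 := by
    rw [← hμ 0 (mem_ball_self one_pos)]
    simp [hne]
  have hslope : Tendsto (slope f 0) (𝓝[≠] 0) (𝓝 0) := by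
    simpa [hf'] using hf.hasDerivAt.tendsto_slope
  have hlow {z : ℂ} (hz : z ∈ ball (0 : ℂ) 2⁻¹) (w : UnitCircle) : 2⁻¹ ≤ ‖(w : ℂ) - z‖ := by
    have h1 := norm_sub_norm_le (w : ℂ) z
    rw [mem_ball_zero_iff] at hz
    rw [norm_eq_of_mem_sphere] at h1
    linarith
  have hcont : ContinuousAt (fun z : ℂ ↦ ∫ w : UnitCircle, 2 / ((w : ℂ) - z) ∂μ) 0 := by
    refine continuousAt_of_dominated (bound := fun _ ↦ 4) ?_ ?_ (integrable_const _) ?_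
    · refine .of_forall fun z ↦ Measurable.aestronglyMeasurable (by fun_prop)
    · filter_upwards [ball_mem_nhds (0 : ℂ) (by norm_num : (0 : ℝ) < 2⁻¹)] with z hz
      refine .of_forall fun w ↦ ?_
      have := hlow hz w
      rw [norm_div, div_le_iff₀ (by linarith)]
      norm_num
      linarith
    · refine .of_forall fun w ↦ ?_
      have : (w : ℂ) - 0 ≠ 0 := by simpa using hne w
      fun_prop (disch := assumption)
  have heq : slope f 0 =ᶠ[𝓝[≠] 0] fun z : ℂ ↦ ∫ w : UnitCircle, 2 / ((w : ℂ) - z) ∂μ := by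
    filter_upwards [self_mem_nhdsWithin, mem_nhdsWithin_of_mem_nhds
      (ball_mem_nhds (0 : ℂ) (by norm_num : (0 : ℝ) < 2⁻¹))] with z hz0 hz
    have hz1 : z ∈ ball (0 : ℂ) 1 := ball_subset_ball (by norm_num) hz
    have hint := (continuous_herglotz hz1).integrable_of_hasCompactSupport (μ := μ)
      (HasCompactSupport.of_compactSpace _)
    have h1 : f z - f 0 = ∫ w : UnitCircle, (((w : ℂ) + z) / ((w : ℂ) - z) - 1) ∂μ := by
      rw [integral_sub hint (integrable_const _), hμ z hz1, h0]
      simp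
    rw [slope_def_field, h1, sub_zero, ← integral_div]
    refine integral_congr_ae (.of_forall fun w ↦ ?_)
    have hw : (w : ℂ) - z ≠ 0 := norm_pos_iff.1 (by linarith [hlow hz w])
    have hz0' : z ≠ 0 := hz0
    field_simp
    ring
  have hzero : ∫ w : UnitCircle, 2 / ((w : ℂ) - 0) ∂μ = 0 :=
    tendsto_nhds_unique (hcont.tendsto.mono_left nhdsWithin_le_nhds) (hslope.congr' heq)
  have hconj (w : UnitCircle) : 2 / ((w : ℂ) - 0) = 2 * conj (w : ℂ) := by
    rw [sub_zero, div_eq_mul_inv, inv_def, normSq_eq_norm_sq, norm_eq_of_mem_sphere]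
    simp
  simp_rw [hconj] at hzero
  rw [integral_const_mul, integral_conj] at hzero
  simpa using hzero

end Herglotz

/-- Every zero-mean probability measure on the circle is a barycentre of `ThetaHat`. -/
theorem exists_isProbabilityMeasure_thetaHat_integral_eq (μ : Measure UnitCircle)
    [IsProbabilityMeasure μ] (hμ : ∫ w : UnitCircle, (w : ℂ) ∂μ = 0) :
    ∃ ν : Measure (Measure UnitCircle), IsProbabilityMeasure ν ∧ ν ThetaHatᶜ = 0 ∧
      ∀ g : C(UnitCircle, ℂ), ∫ ϑ, (∫ w, g w ∂ϑ) ∂ν = ∫ w, g w ∂μ := by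
  obtain ⟨P, hP, hPint⟩ := WeightedTriple.exists_isProbabilityMeasure_integral_eq μ hμ
  have hmap : AEMeasurable WeightedTriple.toMeasure P :=
    WeightedTriple.measurable_toMeasure.aemeasurable
  have hΘ : P.map WeightedTriple.toMeasure ThetaHatᶜ = 0 := by
    rw [Measure.map_apply WeightedTriple.measurable_toMeasure measurableSet_thetaHat.compl]
    convert measure_empty (μ := P)
    exact Set.eq_empty_of_forall_notMem fun p hp ↦ hp (WeightedTriple.toMeasure_mem_thetaHat p)
  refine ⟨P.map WeightedTriple.toMeasure, Measure.isProbabilityMeasure_map hmap, hΘ, fun g ↦ ?_⟩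
  have hint (ϑ : Measure UnitCircle) [IsFiniteMeasure ϑ] : Integrable g ϑ :=
    g.continuous.integrable_of_hasCompactSupport (HasCompactSupport.of_compactSpace _)
  obtain ⟨G, hG, hgG⟩ := exists_measurable_eq_integral g
  have hae : (fun ϑ ↦ ∫ w, g w ∂ϑ) =ᵐ[P.map WeightedTriple.toMeasure] G := by
    filter_upwards [mem_ae_iff.2 hΘ] with ϑ hϑ
    have := hϑ.1
    exact hgG ϑ inferInstance
  rw [integral_map hmap (hG.aestronglyMeasurable.congr hae.symm)]
  have hbdd : Integrable (fun p ↦ ∫ w, g w ∂WeightedTriple.toMeasure p) P := by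
    refine Integrable.of_bound (C := ‖g‖) ?_ (.of_forall fun p ↦ ?_)
    · simp_rw [fun p ↦ hgG (WeightedTriple.toMeasure p) inferInstance]
      exact (hG.comp WeightedTriple.measurable_toMeasure).aestronglyMeasurable
    · exact (norm_integral_le_of_norm_le_const (.of_forall g.norm_coe_le_norm)).trans (by simp)
  refine Complex.ext ?_ ?_
  · have h := hPint ⟨fun w ↦ (g w).re, by fun_prop⟩
    simp only [ContinuousMap.coe_mk] at h
    simp_rw [← RCLike.re_eq_complex_re] at h ⊢
    rw [← integral_re hbdd, ← integral_re (hint μ), ← h]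
    simp_rw [integral_re (hint _)]
  · have h := hPint ⟨fun w ↦ (g w).im, by fun_prop⟩
    simp only [ContinuousMap.coe_mk] at h
    simp_rw [← RCLike.im_eq_complex_im] at h ⊢
    rw [← integral_im hbdd, ← integral_im (hint μ), ← h]
    simp_rw [integral_im (hint _)]

/-- Herglotz–Agler representation: if `f` is analytic on the open unit disc with
`Re f > 0`, `f(0) = 1` and `f'(0) = 0`, then there is a Borel probability measure `ν`
on `Θ̂` such that `f(z) = ∫_Θ̂ h_ϑ(z) dν(ϑ)`, where `h_ϑ(z) = ∫_𝕋 (w+z)/(w-z) dϑ(w)`. -/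
theorem herglotz_agler_representation
    (f : ℂ → ℂ) (hf : DifferentiableOn ℂ f (Metric.ball (0 : ℂ) 1))
    (hre : ∀ z ∈ Metric.ball (0 : ℂ) 1, 0 < (f z).re)
    (h0 : f 0 = 1) (h0' : deriv f 0 = 0) :
    ∃ ν : Measure (Measure UnitCircle), IsProbabilityMeasure ν ∧ ν ThetaHatᶜ = 0 ∧
      ∀ z ∈ Metric.ball (0 : ℂ) 1,
        f z = ∫ ϑ : Measure UnitCircle,
          (∫ w : UnitCircle, ((w : ℂ) + z) / ((w : ℂ) - z) ∂ϑ) ∂ν := by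
  obtain ⟨μ, hμ, hμf⟩ := exists_isProbabilityMeasure_integral_herglotz_eq hf
    (fun z hz ↦ (hre z hz).le) h0
  obtain ⟨ν, hν, hνΘ, hνint⟩ := exists_isProbabilityMeasure_thetaHat_integral_eq μ <|
    integral_coe_eq_zero_of_integral_herglotz_eq
      (hf.differentiableAt (Metric.ball_mem_nhds 0 one_pos)) h0' hμf
  refine ⟨ν, hν, hνΘ, fun z hz ↦ ?_⟩
  rw [← hμf z hz]
  exact (hνint ⟨_, continuous_herglotz hz⟩).symm
end

section
/- The set of zero-mean Borel probability measures on the unit circle is convex and weak-* compact, and each of its extreme points is supported on at most three points of the circle. -/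
open Complex MeasureTheory

/-- The set of zero-mean Borel probability measures on the unit circle. -/
def ZeroMeanProb : Set (Measure UnitCircle) :=
  {μ | IsProbabilityMeasure μ ∧ (∫ w : UnitCircle, (w : ℂ) ∂μ) = 0}

/-- If no set of at most `finrank ℝ E` points carries the measure `μ`, then some bounded
simple function that is a nonzero constant on a set of positive measure is `μ`-orthogonal to the
integrable function `f : X → E`. -/
lemma exists_orthogonal_of_forall_finset_compl_ne_zero {X E : Type*} [TopologicalSpace X]
    [T2Space X] [HereditarilyLindelofSpace X] [MeasurableSpace X] [OpensMeasurableSpace X]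
    [NormedAddCommGroup E] [NormedSpace ℝ E] [FiniteDimensional ℝ E] {μ : Measure X}
    {f : X → E} (hf : Integrable f μ)
    (hμ : ∀ S : Finset X, S.card ≤ Module.finrank ℝ E → μ (↑S)ᶜ ≠ 0) :
    ∃ h : X → ℝ, Measurable h ∧ (∀ x, |h x| ≤ 1) ∧ ∫ x, h x • f x ∂μ = 0 ∧
      ∃ (U : Set X) (k : ℝ), MeasurableSet U ∧ μ U ≠ 0 ∧ k ≠ 0 ∧ ∀ x ∈ U, h x = k := by
  obtain ⟨T, hTs, hT⟩ : ∃ T : Finset X, ↑T ⊆ μ.support ∧ T.card = Module.finrank ℝ E + 1 := by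
    rcases μ.support.finite_or_infinite with hfin | hinf
    · have hlt : Module.finrank ℝ E < hfin.toFinset.card := by
        by_contra! hle
        exact hμ _ hle (by simp)
      obtain ⟨T, hT, hc⟩ := Finset.exists_subset_card_eq (Nat.succ_le_of_lt hlt)
      exact ⟨T, fun x hx => by simpa using hT hx, hc⟩
    · exact hinf.exists_subset_card_eq _
  obtain ⟨U, hU, hdisj⟩ := T.finite_toSet.t2_separation
  have hpos (x : T) : μ (U x) ≠ 0 :=
    ((Measure.mem_support_iff_forall _).1 (hTs x.2) _ ((hU x).2.mem_nhds (hU x).1)).ne'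
  have hmeas (x : T) : MeasurableSet (U x) := (hU x).2.measurableSet
  obtain ⟨c, hc, y, hy⟩ := Fintype.not_linearIndependent_iff.1
    (fun hli : LinearIndependent ℝ fun x : T => ∫ w in U x, f w ∂μ => by
      have := hli.fintype_card_le_finrank
      simp only [Fintype.card_coe] at this
      omega)
  have hval (z : T) (w : X) (hw : w ∈ U z) :
      ∑ x : T, (U x).indicator (fun _ => c x) w = c z := by
    rw [Finset.sum_eq_single z, Set.indicator_of_mem hw]
    · intro x _ hxz
      refine Set.indicator_of_notMem (fun hwx => ?_) _
      exact Set.disjoint_left.1 (hdisj x.2 z.2 (Subtype.coe_injective.ne hxz)) hwx hw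
    · simp
  set M : ℝ := ∑ x : T, |c x|
  have hcM (z : T) : |c z| ≤ M :=
    Finset.single_le_sum (f := fun x => |c x|) (fun _ _ => abs_nonneg _) (Finset.mem_univ z)
  have hM : 0 < M := (abs_pos.2 hy).trans_le (hcM y)
  refine ⟨fun w => M⁻¹ * ∑ x : T, (U x).indicator (fun _ => c x) w, ?_, ?_, ?_,
    U y, M⁻¹ * c y, hmeas y, hpos y, mul_ne_zero (inv_ne_zero hM.ne') hy,
    fun w hw => congrArg (M⁻¹ * ·) (hval y w hw)⟩
  · exact (Finset.measurable_fun_sum _ fun x _ =>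
      measurable_const.indicator (hmeas x)).const_mul _
  · intro w
    rw [abs_mul, abs_of_pos (inv_pos.2 hM), inv_mul_le_one₀ hM]
    refine (Finset.abs_sum_le_sum_abs _ _).trans (Finset.sum_le_sum fun x _ => ?_)
    by_cases hw : w ∈ U x <;> simp [hw]
  · have hsmul (w : X) : (M⁻¹ * ∑ x : T, (U x).indicator (fun _ => c x) w) • f w
        = M⁻¹ • ∑ x : T, c x • (U x).indicator f w := by
      rw [mul_smul, Finset.sum_smul]
      congr 1
      refine Finset.sum_congr rfl fun x _ => ?_
      by_cases hw : w ∈ U x <;> simp [hw]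
    simp_rw [hsmul]
    rw [integral_smul, integral_finsetSum]
    swap
    · exact fun x _ => (hf.indicator (hmeas x)).smul (c x)
    simp_rw [integral_smul, integral_indicator (hmeas _)]
    rw [hc, smul_zero]

lemma integrable_coe_unitCircle (μ : Measure UnitCircle) [IsFiniteMeasure μ] :
    Integrable (fun w : UnitCircle => (w : ℂ)) μ :=
  .of_bound continuous_subtype_val.aestronglyMeasurable 1 (.of_forall fun w => by simp)

lemma withDensity_one_add_mem_zeroMeanProb {μ : Measure UnitCircle} (hμ : μ ∈ ZeroMeanProb)
    {h : UnitCircle → ℝ} (hm : Measurable h) (hb : ∀ x, |h x| ≤ 1)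
    (h0 : ∫ x, h x ∂μ = 0) (h1 : ∫ x : UnitCircle, h x • (x : ℂ) ∂μ = 0) :
    μ.withDensity (fun x => ENNReal.ofReal (1 + h x)) ∈ ZeroMeanProb := by
  have := hμ.1
  have hi : Integrable h μ := .of_bound hm.aestronglyMeasurable 1 (.of_forall hb)
  have hnn (x : UnitCircle) : 0 ≤ 1 + h x := by linarith [neg_le_of_abs_le (hb x)]
  have hw := integrable_coe_unitCircle μ
  have hhw : Integrable (fun x : UnitCircle => h x • (x : ℂ)) μ :=
    hw.bdd_smul 1 hm.aestronglyMeasurable (.of_forall hb)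
  refine ⟨⟨?_⟩, ?_⟩
  · rw [withDensity_apply _ .univ, Measure.restrict_univ,
      ← ofReal_integral_eq_lintegral_ofReal (f := fun x => 1 + h x) ((integrable_const 1).add hi)
        (.of_forall hnn),
      integral_add (integrable_const 1) hi, h0]
    simp
  · rw [integral_withDensity_eq_integral_toReal_smul (by fun_prop)
      (.of_forall fun _ => ENNReal.ofReal_lt_top)]
    simp_rw [ENNReal.toReal_ofReal (hnn _), add_smul, one_smul]
    rw [integral_add hw hhw, h1, hμ.2, add_zero]

lemma ofReal_half_smul_withDensity_add {X : Type*} [MeasurableSpace X] (μ : Measure X)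
    {h : X → ℝ} (hm : Measurable h) (hb : ∀ x, |h x| ≤ 1) :
    μ = ENNReal.ofReal (1 / 2) • μ.withDensity (fun x => ENNReal.ofReal (1 + h x)) +
      ENNReal.ofReal (1 - 1 / 2) • μ.withDensity (fun x => ENNReal.ofReal (1 + -h x)) := by
  rw [← withDensity_smul _ (by fun_prop), ← withDensity_smul _ (by fun_prop),
    ← withDensity_add_left (by fun_prop)]
  nth_rewrite 1 [← withDensity_one (μ := μ)]
  congr 1
  funext x
  have := abs_le.1 (hb x)
  simp only [Pi.one_apply, Pi.add_apply, Pi.smul_apply, smul_eq_mul]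
  rw [← ENNReal.ofReal_mul (by norm_num), ← ENNReal.ofReal_mul (by norm_num),
    ← ENNReal.ofReal_add (by linarith) (by linarith), ← ENNReal.ofReal_one]
  congr 1
  ring

lemma smul_add_smul_mem_zeroMeanProb {μ₁ μ₂ : Measure UnitCircle} (h₁ : μ₁ ∈ ZeroMeanProb)
    (h₂ : μ₂ ∈ ZeroMeanProb) {t : ℝ} (ht₀ : 0 ≤ t) (ht₁ : t ≤ 1) :
    ENNReal.ofReal t • μ₁ + ENNReal.ofReal (1 - t) • μ₂ ∈ ZeroMeanProb := by
  have := h₁.1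
  have := h₂.1
  refine ⟨⟨?_⟩, ?_⟩
  · simp only [Measure.coe_add, Measure.coe_smul, Pi.add_apply, Pi.smul_apply, measure_univ,
      smul_eq_mul, mul_one]
    rw [← ENNReal.ofReal_add ht₀ (by linarith)]
    simp
  · rw [integral_add_measure
      ((integrable_coe_unitCircle μ₁).smul_measure ENNReal.ofReal_ne_top)
      ((integrable_coe_unitCircle μ₂).smul_measure ENNReal.ofReal_ne_top),
      integral_smul_measure, integral_smul_measure, h₁.2, h₂.2]
    simp

lemma isCompact_setOf_integral_coe_eq_zero :
    IsCompact {μ : ProbabilityMeasure UnitCircle |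
      (∫ w : UnitCircle, (w : ℂ) ∂(μ : Measure UnitCircle)) = 0} := by
  have hcont : Continuous fun μ : ProbabilityMeasure UnitCircle =>
      ∫ w : UnitCircle, (w : ℂ) ∂(μ : Measure UnitCircle) :=
    continuous_iff_continuousAt.2 fun μ =>
      (ProbabilityMeasure.tendsto_iff_forall_integral_rclike_tendsto ℂ).1 Filter.tendsto_id
        (BoundedContinuousFunction.mkOfCompact ⟨Subtype.val, continuous_subtype_val⟩)
  exact (isClosed_eq hcont continuous_const).isCompact

lemma exists_finset_card_le_three_of_extreme {μ : Measure UnitCircle} (hμ : μ ∈ ZeroMeanProb)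
    (hext : ∀ μ₁ ∈ ZeroMeanProb, ∀ μ₂ ∈ ZeroMeanProb, ∀ t : ℝ, 0 < t → t < 1 →
      μ = ENNReal.ofReal t • μ₁ + ENNReal.ofReal (1 - t) • μ₂ → μ₁ = μ ∧ μ₂ = μ) :
    ∃ S : Finset UnitCircle, S.card ≤ 3 ∧ μ (↑S)ᶜ = 0 := by
  by_contra! hS
  have := hμ.1
  have hrank : Module.finrank ℝ (ℝ × ℂ) = 3 := by
    simp [Module.finrank_prod, Complex.finrank_real_complex]
  have hf : Integrable (fun w : UnitCircle => ((1 : ℝ), (w : ℂ))) μ :=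
    (integrable_const 1).prodMk (integrable_coe_unitCircle μ)
  obtain ⟨h, hm, hb, horth, U, k, hU, hμU, hk, hhk⟩ :=
    exists_orthogonal_of_forall_finset_compl_ne_zero hf (by rwa [hrank])
  have hhf : Integrable (fun w : UnitCircle => h w • ((1 : ℝ), (w : ℂ))) μ :=
    hf.bdd_smul 1 hm.aestronglyMeasurable (.of_forall hb)
  have h0 : ∫ x, h x ∂μ = 0 := by
    have := fst_integral hhf
    rw [horth] at this
    simpa using this.symm
  have h1 : ∫ x : UnitCircle, h x • (x : ℂ) ∂μ = 0 := by
    have := snd_integral hhf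
    rw [horth] at this
    simpa using this.symm
  have heq := (hext _ (withDensity_one_add_mem_zeroMeanProb hμ hm hb h0 h1)
    _ (withDensity_one_add_mem_zeroMeanProb hμ hm.neg (fun x => by simpa using hb x)
      (by simp [integral_neg, h0]) (by simpa [integral_neg] using h1))
    (1 / 2) (by norm_num) (by norm_num) (ofReal_half_smul_withDensity_add μ hm hb)).1
  have hUeq := congrArg (fun ν : Measure UnitCircle => ν U) heq
  simp only [withDensity_apply _ hU] at hUeq
  rw [setLIntegral_congr_fun hU (g := fun _ => ENNReal.ofReal (1 + k))
    (fun x hx => by simp only [hhk x hx]), setLIntegral_const] at hUeq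
  have hone : ENNReal.ofReal (1 + k) = 1 :=
    (ENNReal.mul_left_inj hμU (measure_ne_top μ U)).1 (by rw [hUeq, one_mul])
  rw [ENNReal.ofReal_eq_one] at hone
  exact hk (by linarith)

/-- The set of zero-mean Borel probability measures on the unit circle is convex and
weak-* compact, and each of its extreme points is supported on at most three points
of the circle. -/
theorem zero_mean_prob_convex_compact_extreme_points :
    (∀ μ₁ ∈ ZeroMeanProb, ∀ μ₂ ∈ ZeroMeanProb, ∀ t : ℝ, 0 ≤ t → t ≤ 1 →
      ENNReal.ofReal t • μ₁ + ENNReal.ofReal (1 - t) • μ₂ ∈ ZeroMeanProb) ∧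
    IsCompact {μ : ProbabilityMeasure UnitCircle |
      (∫ w : UnitCircle, (w : ℂ) ∂(μ : Measure UnitCircle)) = 0} ∧
    (∀ μ ∈ ZeroMeanProb,
      (∀ μ₁ ∈ ZeroMeanProb, ∀ μ₂ ∈ ZeroMeanProb, ∀ t : ℝ, 0 < t → t < 1 →
        μ = ENNReal.ofReal t • μ₁ + ENNReal.ofReal (1 - t) • μ₂ →
        μ₁ = μ ∧ μ₂ = μ) →
      ∃ S : Finset UnitCircle, S.card ≤ 3 ∧ μ (↑S)ᶜ = 0) :=
  ⟨fun _ h₁ _ h₂ _ ht₀ ht₁ => smul_add_smul_mem_zeroMeanProb h₁ h₂ ht₀ ht₁,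
    isCompact_setOf_integral_coe_eq_zero,
    fun _ hμ hext => exists_finset_card_le_three_of_extreme hμ hext⟩
end
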